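/- Hammersley–Clifford theorem: Let V be a finite index set, let α_v be a finite nonempty type for each v ∈ V, let G be a simple graph on V, and let μ be a strictly positive probability measure on Π_{v∈V} α_v (every single point has positive probability) satisfying the pairwise Markov property with respect to G: for all distinct non-adjacent vertices X, Y of G, CI_μ({X},{Y}, V∖{X,Y}). Then μ factorizes as a Gibbs distribution over the cliques of G: there exist a finite family (c_j)_{j∈J} of cliques of G and positive functions g_j, each depending only on the coordinates in c_j, and a normalization constant Z > 0, such that μ{f} = (1/Z) ∏_{j∈J} g_j(f restricted to c_j) for every f. -/

import Mathlib

open scoped ENNReal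

/-- The probability, under the distribution `μ`, of the event that a random
assignment agrees with `x` on all the coordinates in `S`. -/
noncomputable def prMatch {V : Type*} [Fintype V] [DecidableEq V]
    {α : V → Type*} [∀ v, Fintype (α v)] [∀ v, DecidableEq (α v)]
    (μ : PMF (∀ v, α v)) (S : Finset V) (x : ∀ v, α v) : ℝ≥0∞ :=
  ∑ f ∈ Finset.univ.filter (fun f : ∀ v, α v => ∀ v ∈ S, f v = x v), μ f

/-- `A` is conditionally independent of `B` given `C` under `μ`:
for every assignment `x`,
`μ{f agrees with x on A∪B∪C} ⬝ μ{f agrees with x on C}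
  = μ{f agrees with x on A∪C} ⬝ μ{f agrees with x on B∪C}`. -/
def CondIndep {V : Type*} [Fintype V] [DecidableEq V]
    {α : V → Type*} [∀ v, Fintype (α v)] [∀ v, DecidableEq (α v)]
    (μ : PMF (∀ v, α v)) (A B C : Finset V) : Prop :=
  ∀ x : ∀ v, α v,
    prMatch μ (A ∪ B ∪ C) x * prMatch μ C x
      = prMatch μ (A ∪ C) x * prMatch μ (B ∪ C) x

/-- The Möbius transform of a set function over the subset lattice. -/
def Finset.moebiusTransform {V : Type*} (H : Finset V → ℝ) (S : Finset V) : ℝ :=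
  ∑ T ∈ S.powerset, (-1) ^ (S.card + T.card) * H T

namespace Finset

variable {V : Type*}

theorem moebiusTransform_congr {H K : Finset V → ℝ} {S : Finset V}
    (h : ∀ T ⊆ S, H T = K T) : moebiusTransform H S = moebiusTransform K S :=
  sum_congr rfl fun T hT => by rw [h T (mem_powerset.1 hT)]

theorem moebiusTransform_insert [DecidableEq V] (H : Finset V → ℝ) {S : Finset V} {a : V}
    (ha : a ∉ S) :
    moebiusTransform H (insert a S)
      = moebiusTransform (fun T => H (insert a T)) S - moebiusTransform H S := by
  simp only [moebiusTransform]
  rw [sum_powerset_insert ha, add_comm, sub_eq_add_neg, ← sum_neg_distrib]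
  congr 1 <;> refine sum_congr rfl fun T hT => ?_
  · rw [card_insert_of_notMem ha,
      card_insert_of_notMem fun h => ha (mem_powerset.1 hT h)]
    ring
  · rw [card_insert_of_notMem ha]
    ring

theorem sum_powerset_moebiusTransform [DecidableEq V] (U : Finset V) (H : Finset V → ℝ) :
    ∑ S ∈ U.powerset, moebiusTransform H S = H U := by
  induction U using Finset.induction_on generalizing H with
  | empty => simp [moebiusTransform]
  | insert a U ha ih =>
    rw [sum_powerset_insert ha, ← ih fun T => H (insert a T), ← sum_add_distrib]
    refine sum_congr rfl fun S hS => ?_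
    rw [moebiusTransform_insert H fun h => ha (mem_powerset.1 hS h)]
    ring

theorem moebiusTransform_eq_zero [DecidableEq V] {H : Finset V → ℝ} {S : Finset V} {x y : V}
    (hx : x ∈ S) (hy : y ∈ S) (hxy : x ≠ y)
    (h : ∀ T, x ∉ T → y ∉ T →
      H (insert x (insert y T)) + H T = H (insert x T) + H (insert y T)) :
    moebiusTransform H S = 0 := by
  have hyR : y ∉ (S.erase x).erase y := notMem_erase _ _
  have hxR : x ∉ insert y ((S.erase x).erase y) := by simp [hxy]
  rw [← insert_erase hx, ← insert_erase (mem_erase.2 ⟨hxy.symm, hy⟩),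
    moebiusTransform_insert _ hxR, moebiusTransform_insert _ hyR,
    moebiusTransform_insert _ hyR]
  simp only [moebiusTransform, ← sum_sub_distrib]
  refine sum_eq_zero fun T hT => ?_
  have hT' := mem_powerset.1 hT
  have := h T (fun hh => hxR (mem_insert_of_mem (hT' hh))) (fun hh => hyR (hT' hh))
  linear_combination (-1) ^ (((S.erase x).erase y).card + T.card) * this

end Finset

section PairwiseMarkov

variable {V : Type*} [Fintype V] [DecidableEq V]
  {α : V → Type*} [∀ v, Fintype (α v)] [∀ v, DecidableEq (α v)]

theorem prMatch_congr (μ : PMF (∀ v, α v)) {S : Finset V} {x y : ∀ v, α v}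
    (h : ∀ v ∈ S, x v = y v) : prMatch μ S x = prMatch μ S y := by
  unfold prMatch
  congr 1
  ext f
  simp only [Finset.mem_filter, Finset.mem_univ, true_and]
  exact forall₂_congr fun v hv => by rw [h v hv]

theorem prMatch_univ (μ : PMF (∀ v, α v)) (x : ∀ v, α v) :
    prMatch μ Finset.univ x = μ x := by
  refine Finset.sum_eq_single_of_mem x (by simp) fun f hf hfx => absurd ?_ hfx
  exact funext fun v => (Finset.mem_filter.1 hf).2 v (Finset.mem_univ v)

theorem prMatch_ne_top (μ : PMF (∀ v, α v)) (S : Finset V) (x : ∀ v, α v) :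
    prMatch μ S x ≠ ⊤ :=
  ENNReal.sum_ne_top.2 fun f _ => μ.apply_ne_top f

theorem prMatch_ne_zero {μ : PMF (∀ v, α v)} (hpos : ∀ f, 0 < μ f) (S : Finset V)
    (x : ∀ v, α v) : prMatch μ S x ≠ 0 := fun h =>
  (hpos x).ne' (Finset.sum_eq_zero_iff.1 h x (by simp))

/-- Exchange identity: `z₁`, `z₃` and `z₂`, `z₄` differ at most at `y`, while `z₁`, `z₄` and
`z₂`, `z₃` differ at most at `x`. -/
theorem CondIndep.mul_eq_mul {μ : PMF (∀ v, α v)} (hpos : ∀ f, 0 < μ f) {x y : V}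
    (h : CondIndep μ {x} {y} (Finset.univ \ {x, y})) {z₁ z₂ z₃ z₄ : ∀ v, α v}
    (h₁₃ : ∀ v ≠ y, z₁ v = z₃ v) (h₂₄ : ∀ v ≠ y, z₂ v = z₄ v)
    (h₁₄ : ∀ v ≠ x, z₁ v = z₄ v) (h₂₃ : ∀ v ≠ x, z₂ v = z₃ v) (hxy : x ≠ y) :
    μ z₁ * μ z₂ = μ z₃ * μ z₄ := by
  set C : Finset V := Finset.univ \ {x, y} with hC
  have huniv : {x} ∪ {y} ∪ C = Finset.univ := by
    ext v; simp [hC]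
  have hCx : ∀ v ∈ C, v ≠ x := by simp +contextual [hC]
  have hCy : ∀ v ∈ C, v ≠ y := by simp +contextual [hC]
  have hxC : ∀ v ∈ {x} ∪ C, v ≠ y := by
    simp only [Finset.mem_union, Finset.mem_singleton]
    rintro v (rfl | hv)
    exacts [hxy, hCy v hv]
  have hyC : ∀ v ∈ {y} ∪ C, v ≠ x := by
    simp only [Finset.mem_union, Finset.mem_singleton]
    rintro v (rfl | hv)
    exacts [hxy.symm, hCx v hv]
  have e (z) := h z
  simp only [huniv, prMatch_univ] at e
  have e₁ := e z₁
  have e₂ := e z₂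
  have e₃ := e z₃
  have e₄ := e z₄
  rw [prMatch_congr μ fun v hv => h₁₃ v (hCy v hv),
    prMatch_congr μ fun v hv => h₁₃ v (hxC v hv),
    prMatch_congr μ fun v hv => h₁₄ v (hyC v hv)] at e₁
  rw [prMatch_congr μ fun v hv => h₂₃ v (hCx v hv),
    prMatch_congr μ fun v hv => h₂₄ v (hxC v hv),
    prMatch_congr μ fun v hv => h₂₃ v (hyC v hv)] at e₂
  rw [← prMatch_congr μ fun v hv => h₂₄ v (hCy v hv),
    prMatch_congr μ fun v hv => h₂₃ v (hCx v hv)] at e₄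
  have hs := prMatch_ne_zero hpos C z₃
  have ht := prMatch_ne_top μ C z₃
  refine (ENNReal.mul_left_inj (mul_ne_zero hs hs) (ENNReal.mul_ne_top ht ht)).1 ?_
  rw [mul_mul_mul_comm, e₁, e₂, mul_mul_mul_comm (μ z₃), e₃, e₄]
  ring

end PairwiseMarkov

/-- Hammersley–Clifford theorem: a strictly positive distribution satisfying
the pairwise Markov property with respect to a simple graph `G` factorizes
as a Gibbs distribution over the cliques of `G`: there is a finite family of
cliques `c j` and positive functions `g j`, each depending only on the
coordinates in `c j`, and a normalization constant `Z > 0`, such that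
`μ f = (1/Z) * ∏ j, g j f` for every `f`. -/
theorem hammersley_clifford {V : Type*} [Fintype V] [DecidableEq V]
    {α : V → Type*} [∀ v, Fintype (α v)] [∀ v, DecidableEq (α v)]
    [∀ v, Nonempty (α v)]
    (G : SimpleGraph V) (μ : PMF (∀ v, α v))
    (hpos : ∀ f : ∀ v, α v, 0 < μ f)
    (hpairwise : ∀ X Y : V, X ≠ Y → ¬ G.Adj X Y →
      CondIndep μ {X} {Y} (Finset.univ \ {X, Y})) :
    ∃ (ι : Type) (J : Finset ι) (c : ι → Finset V)
      (g : ι → (∀ v, α v) → ℝ≥0∞) (Z : ℝ≥0∞),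
      (∀ j ∈ J, G.IsClique (c j : Set V)) ∧
      (∀ j ∈ J, ∀ f f' : ∀ v, α v, (∀ v ∈ c j, f v = f' v) → g j f = g j f') ∧
      (∀ j ∈ J, ∀ f : ∀ v, α v, 0 < g j f) ∧
      0 < Z ∧
      ∀ f : ∀ v, α v, μ f = (1 / Z) * ∏ j ∈ J, g j f := by
  classical
  obtain ⟨a⟩ : Nonempty (∀ v, α v) := inferInstance
  let mix (f : ∀ v, α v) (S : Finset V) : ∀ v, α v := S.piecewise f a
  let H (f : ∀ v, α v) (S : Finset V) : ℝ := Real.log (μ (mix f S)).toReal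
  have hreal (f) : 0 < (μ f).toReal := ENNReal.toReal_pos (hpos f).ne' (μ.apply_ne_top f)
  have hzero (f) (S : Finset V) (hS : ¬ G.IsClique (S : Set V)) :
      Finset.moebiusTransform (H f) S = 0 := by
    simp only [SimpleGraph.IsClique, Set.Pairwise, not_forall] at hS
    obtain ⟨x, hx, y, hy, hxy, hadj⟩ := hS
    refine Finset.moebiusTransform_eq_zero hx hy hxy fun T hxT hyT => ?_
    have key := (hpairwise x y hxy hadj).mul_eq_mul hpos
      (z₁ := mix f (insert x (insert y T))) (z₂ := mix f T)
      (z₃ := mix f (insert x T)) (z₄ := mix f (insert y T))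
      (fun v hv => by simp [mix, Finset.piecewise, hv])
      (fun v hv => by simp [mix, Finset.piecewise, hv])
      (fun v hv => by simp [mix, Finset.piecewise, hv])
      (fun v hv => by simp [mix, Finset.piecewise, hv]) hxy
    have key' := congrArg (fun r => Real.log r.toReal) key
    simpa only [ENNReal.toReal_mul, Real.log_mul (hreal _).ne' (hreal _).ne'] using key'
  let e := Fintype.equivFin {S : Finset V // G.IsClique (S : Set V)}
  refine ⟨Fin (Fintype.card {S : Finset V // G.IsClique (S : Set V)}), Finset.univ,
    fun j => (e.symm j).1,
    fun j f => ENNReal.ofReal (Real.exp (Finset.moebiusTransform (H f) (e.symm j).1)), 1,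
    fun j _ => (e.symm j).2, fun j _ f f' h => ?_,
    fun j _ f => ENNReal.ofReal_pos.2 (Real.exp_pos _), one_pos, fun f => ?_⟩
  · dsimp only
    rw [Finset.moebiusTransform_congr fun T hT => ?_]
    have : mix f T = mix f' T :=
      Finset.piecewise_congr T (fun v hv => h v (hT hv)) fun _ _ => rfl
    simp only [H, this]
  · rw [div_one, one_mul,
      e.symm.prod_comp fun S : {S : Finset V // G.IsClique (S : Set V)} =>
        ENNReal.ofReal (Real.exp (Finset.moebiusTransform (H f) S.1)),
      ← ENNReal.ofReal_prod_of_nonneg fun _ _ => (Real.exp_pos _).le, ← Real.exp_sum]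
    have hsum : ∑ S : {S : Finset V // G.IsClique (S : Set V)},
        Finset.moebiusTransform (H f) S.1 = H f Finset.univ := by
      rw [← Finset.sum_powerset_moebiusTransform Finset.univ (H f), Finset.powerset_univ,
        ← Finset.sum_filter_of_ne (p := fun S : Finset V => G.IsClique (S : Set V))
          fun S _ hS => not_not.1 fun h => hS (hzero f S h)]
      exact (Finset.sum_subtype _ (by simp) _).symm
    have hmix : mix f Finset.univ = f := Finset.piecewise_univ f a
    rw [hsum, Real.exp_log (hreal _), hmix, ENNReal.ofReal_toReal (μ.apply_ne_top f)]
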